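/- For every positive integer n one has #B_n = q^n, #E_n = q^{2n}, #F_n = ζ_A(2)^{−1} q^{2n}, and #I_n = 2 ζ_A(2)^{−1} q^{2n−1}. -/

import Mathlib

open Polynomial UniqueFactorizationMonoid

noncomputable section

namespace EvenChar

variable {Fq : Type} [Field Fq] [Fintype Fq]

variable (Fq) in
/-- The family `F_n` of real quadratic `u`'s. -/
def Ffam (n : ℕ) : Set (RatFunc Fq) :=
  { u | ∃ (S : Finset (Polynomial Fq)) (e : Polynomial Fq → ℕ)
        (a : Polynomial Fq → ℕ → Polynomial Fq),
      (∀ P ∈ S, P.Monic ∧ Irreducible P) ∧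
      (∀ P ∈ S, 1 ≤ e P) ∧
      (∀ P ∈ S, ∀ i, 1 ≤ i → i ≤ e P → (a P i).degree < P.degree) ∧
      (∀ P ∈ S, a P (e P) ≠ 0) ∧
      (∑ P ∈ S, e P * P.natDegree) = n ∧
      u = ∑ P ∈ S, ∑ i ∈ Finset.Icc 1 (e P),
            algebraMap (Polynomial Fq) (RatFunc Fq) (a P i) /
              algebraMap (Polynomial Fq) (RatFunc Fq) P ^ (2 * i - 1) }

/-- The family `G_s` of odd polynomial parts. -/
def Gfam (ξ : Fq) (s : ℕ) : Set (Polynomial Fq) :=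
  { G | ∃ (α : Fq) (c : ℕ → Fq), (α = 0 ∨ α = ξ) ∧ c s ≠ 0 ∧
      G = C α + ∑ i ∈ Finset.Icc 1 s, C (c i) * X ^ (2 * i - 1) }

/-- The family `I_{(r,s)}`. -/
def Irs (ξ : Fq) (r s : ℕ) : Set (RatFunc Fq) :=
  { u | ∃ v ∈ Ffam Fq r, ∃ G ∈ Gfam ξ s,
      u = v + algebraMap (Polynomial Fq) (RatFunc Fq) G }

/-- The family `I_n` of ramified imaginary `u`'s. -/
def Ifam (ξ : Fq) (n : ℕ) : Set (RatFunc Fq) :=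
  ⋃ (r : ℕ) (s : ℕ) (_ : 1 ≤ s) (_ : r + s = n), Irs ξ r s

variable (Fq) in
open scoped Classical in
/-- The family `B_n`: monic `M` with every valuation `ν_P(M)` zero or odd and
`deg t(M) = 2n`, where `t(M) = M · ∏_{P ∣ M} P`. -/
def Bfam (n : ℕ) : Set (Polynomial Fq) :=
  { M | M.Monic ∧
      (∀ P ∈ (normalizedFactors M).toFinset, Odd ((normalizedFactors M).count P)) ∧
      M.natDegree + ∑ P ∈ (normalizedFactors M).toFinset, P.natDegree = 2 * n }

variable (Fq) in
open scoped Classical in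
/-- The family `E_n`, realized as the set of pairs `(D, M)` with `M ∈ B_n`,
`deg D < deg M`, and `D/M` of the odd-power partial fraction form w.r.t. `M`. -/
def Efam (n : ℕ) : Set (Polynomial Fq × Polynomial Fq) :=
  { p | p.2 ∈ Bfam Fq n ∧ p.1.degree < p.2.degree ∧
      ∃ a : Polynomial Fq → ℕ → Polynomial Fq,
        (∀ P ∈ (normalizedFactors p.2).toFinset, ∀ i, 1 ≤ i →
            i ≤ ((normalizedFactors p.2).count P + 1) / 2 → (a P i).degree < P.degree) ∧
        algebraMap (Polynomial Fq) (RatFunc Fq) p.1 /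
            algebraMap (Polynomial Fq) (RatFunc Fq) p.2 =
          ∑ P ∈ (normalizedFactors p.2).toFinset,
            ∑ i ∈ Finset.Icc 1 (((normalizedFactors p.2).count P + 1) / 2),
              algebraMap (Polynomial Fq) (RatFunc Fq) (a P i) /
                algebraMap (Polynomial Fq) (RatFunc Fq) P ^ (2 * i - 1) }

/-- `ζ_A(s) = (1 - q^{1-s})⁻¹`, real version. -/
def zetaR (q : ℕ) (s : ℝ) : ℝ := (1 - (q : ℝ) ^ ((1 : ℝ) - s))⁻¹

/-! ### Factorization helpers -/

section Helpers

set_option linter.unusedSectionVars false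
set_option linter.unusedVariables false

open scoped Classical

/-- Multiset of normalized factors. -/
abbrev nf (M : Fq[X]) : Multiset Fq[X] := normalizedFactors M

theorem nf_spec {M P : Fq[X]} (h : P ∈ nf M) : P.Monic ∧ Irreducible P := by
  have h1 := irreducible_of_normalized_factor P h
  refine ⟨?_, h1⟩
  have := normalize_normalized_factor P h
  rw [← this]
  exact monic_normalize h1.ne_zero

theorem nf_prod (s : Multiset Fq[X]) (hs : ∀ P ∈ s, P.Monic ∧ Irreducible P) :
    nf s.prod = s := by
  unfold nf
  rw [normalizedFactors_prod_eq s (fun a ha => (hs a ha).2)]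
  conv_rhs => rw [← Multiset.map_id s]
  exact Multiset.map_congr rfl (fun a ha => (hs a ha).1.normalize_eq_self)

theorem prod_nf {M : Fq[X]} (hM : M.Monic) : (nf M).prod = M := by
  unfold nf
  rw [prod_normalizedFactors_eq hM.ne_zero, hM.normalize_eq_self]

theorem pow_dvd_iff_count {M P : Fq[X]} (hM : M.Monic) (hP : P.Monic) (hi : Irreducible P) (k : ℕ) :
    P ^ k ∣ M ↔ k ≤ (nf M).count P := by
  rw [pow_dvd_iff_le_emultiplicity, emultiplicity_eq_count_normalizedFactors hi hM.ne_zero,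
    hP.normalize_eq_self]
  exact Nat.cast_le

theorem natDegree_eq_sum {M : Fq[X]} (hM : M.Monic) :
    M.natDegree = ∑ P ∈ (nf M).toFinset, (nf M).count P * P.natDegree := by
  conv_lhs => rw [← prod_nf hM, Finset.prod_multiset_count]
  rw [natDegree_prod_of_monic]
  · refine Finset.sum_congr rfl fun P hP => ?_
    rw [natDegree_pow]
  · intro P hP
    exact (nf_spec (Multiset.mem_toFinset.1 hP)).1.pow _

/-- Change all the valuations of `M` by the function `g`. -/
def Tg (g : ℕ → ℕ) (M : Fq[X]) : Fq[X] := ∏ P ∈ (nf M).toFinset, P ^ g ((nf M).count P)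

theorem Tg_monic (g : ℕ → ℕ) (M : Fq[X]) : (Tg g M).Monic :=
  monic_prod_of_monic _ _ fun P hP => (nf_spec (Multiset.mem_toFinset.1 hP)).1.pow _

theorem nf_Tg (g : ℕ → ℕ) (M : Fq[X]) :
    nf (Tg g M) = ∑ P ∈ (nf M).toFinset, Multiset.replicate (g ((nf M).count P)) P := by
  have : Tg g M =
      (∑ P ∈ (nf M).toFinset, Multiset.replicate (g ((nf M).count P)) P).prod := by
    rw [Multiset.prod_sum]
    simp [Tg]
  rw [this, nf_prod]
  intro P hP
  rw [Multiset.mem_sum] at hP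
  obtain ⟨Q, hQ, hPQ⟩ := hP
  rw [Multiset.eq_of_mem_replicate hPQ]
  exact nf_spec (Multiset.mem_toFinset.1 hQ)

theorem count_Tg (g : ℕ → ℕ) (g0 : g 0 = 0) (M P : Fq[X]) :
    (nf (Tg g M)).count P = g ((nf M).count P) := by
  rw [nf_Tg, Multiset.count_sum']
  simp_rw [Multiset.count_replicate]
  rw [Finset.sum_ite_eq']
  split_ifs with h
  · rfl
  · rw [Multiset.mem_toFinset, ← Multiset.count_eq_zero] at h
    rw [h, g0]

theorem ext_count {M N : Fq[X]} (hM : M.Monic) (hN : N.Monic)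
    (h : ∀ P, (nf M).count P = (nf N).count P) : M = N := by
  rw [← prod_nf hM, ← prod_nf hN, Multiset.ext.2 h]

theorem support_Tg (g : ℕ → ℕ) (g0 : ∀ c, g c = 0 ↔ c = 0) (M : Fq[X]) :
    (nf (Tg g M)).toFinset = (nf M).toFinset := by
  ext P
  rw [Multiset.mem_toFinset, Multiset.mem_toFinset, ← Multiset.count_ne_zero,
    ← Multiset.count_ne_zero, count_Tg g ((g0 0).2 rfl), Ne, Ne, g0]

theorem ncard_degLT (n : ℕ) : {p : Fq[X] | p.degree < n}.ncard = Fintype.card Fq ^ n ∧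
    {p : Fq[X] | p.degree < n}.Finite := by
  have h : {p : Fq[X] | p.degree < n} = (degreeLT Fq n : Set Fq[X]) := by
    ext p; simp [mem_degreeLT]
  rw [h]
  have e := (degreeLTEquiv Fq n).toEquiv
  have : Finite (degreeLT Fq n) := Finite.of_equiv _ e.symm
  refine ⟨?_, Set.toFinite _⟩
  rw [← Nat.card_coe_set_eq]
  rw [show Nat.card ((degreeLT Fq n : Set Fq[X])) = Nat.card (Fin n → Fq) from Nat.card_congr e]
  simp

/-- Monic polynomials of degree `n`. -/
def Mon (Fq : Type) [Field Fq] (n : ℕ) : Set Fq[X] := {p | p.Monic ∧ p.natDegree = n}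

theorem ncard_Mon (n : ℕ) : (Mon Fq n).ncard = Fintype.card Fq ^ n ∧ (Mon Fq n).Finite := by
  have e := (monicEquivDegreeLT (R := Fq) n).trans (degreeLTEquiv Fq n).toEquiv
  have : Finite (Mon Fq n) := Finite.of_equiv _ e.symm
  refine ⟨?_, Set.toFinite _⟩
  rw [← Nat.card_coe_set_eq]
  rw [show Nat.card (Mon Fq n) = Nat.card (Fin n → Fq) from Nat.card_congr e]
  simp

/-- `N ↦ M`. -/
abbrev gUp (c : ℕ) : ℕ := 2 * c - 1
/-- `M ↦ N`. -/
abbrev gDn (c : ℕ) : ℕ := (c + 1) / 2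

theorem Tg_up_mem {n : ℕ} {N : Fq[X]} (hN : N ∈ Mon Fq n) : Tg gUp N ∈ Bfam Fq n := by
  refine ⟨Tg_monic _ _, ?_, ?_⟩
  · intro P hP
    change P ∈ (nf (Tg gUp N)).toFinset at hP
    change Odd ((nf (Tg gUp N)).count P)
    rw [support_Tg gUp (by intro c; unfold gUp; omega), Multiset.mem_toFinset,
      ← Multiset.count_pos] at hP
    rw [count_Tg gUp rfl]
    exact ⟨(nf N).count P - 1, by unfold gUp; omega⟩
  · change _ + ∑ P ∈ (nf (Tg gUp N)).toFinset, P.natDegree = _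
    rw [natDegree_eq_sum (Tg_monic _ _), support_Tg gUp (by intro c; unfold gUp; omega),
      ← Finset.sum_add_distrib, ← hN.2, natDegree_eq_sum hN.1, Finset.mul_sum]
    refine Finset.sum_congr rfl fun P hP => ?_
    rw [Multiset.mem_toFinset, ← Multiset.count_pos] at hP
    rw [count_Tg gUp rfl]
    obtain ⟨c, hc⟩ : ∃ c, (nf N).count P = c + 1 := ⟨_, (Nat.succ_pred_eq_of_pos hP).symm⟩
    rw [hc]
    have : gUp (c + 1) = 2 * c + 1 := by unfold gUp; omega
    rw [this]; ring

theorem Tg_dn_mem {n : ℕ} {M : Fq[X]} (hM : M ∈ Bfam Fq n) :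
    Tg gDn M ∈ Mon Fq n ∧ Tg gUp (Tg gDn M) = M := by
  obtain ⟨h1, h2, h3⟩ := hM
  change ∀ P ∈ (nf M).toFinset, Odd ((nf M).count P) at h2
  change _ + ∑ P ∈ (nf M).toFinset, P.natDegree = _ at h3
  refine ⟨⟨Tg_monic _ _, ?_⟩, ?_⟩
  · rw [natDegree_eq_sum (Tg_monic _ _), support_Tg gDn (by intro c; unfold gDn; omega)]
    rw [natDegree_eq_sum h1, ← Finset.sum_add_distrib] at h3
    refine Nat.eq_of_mul_eq_mul_left (show 0 < 2 by norm_num) ?_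
    rw [← h3, Finset.mul_sum]
    refine Finset.sum_congr rfl fun P hP => ?_
    obtain ⟨c, hc⟩ := h2 P hP
    rw [count_Tg gDn rfl, hc]
    have : gDn (2 * c + 1) = c + 1 := by unfold gDn; omega
    rw [this]; ring
  · refine ext_count (Tg_monic _ _) h1 fun P => ?_
    rw [count_Tg gUp rfl, count_Tg gDn rfl]
    by_cases hP : P ∈ (nf M).toFinset
    · obtain ⟨c, hc⟩ := h2 P hP
      rw [hc]; unfold gUp gDn; omega
    · rw [Multiset.mem_toFinset, ← Multiset.count_eq_zero] at hP
      rw [hP]; rfl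

theorem Tg_dn_up {N : Fq[X]} (hN : N.Monic) : Tg gDn (Tg gUp N) = N := by
  refine ext_count (Tg_monic _ _) hN fun P => ?_
  rw [count_Tg gDn rfl, count_Tg gUp rfl]
  unfold gUp gDn; omega

theorem ncard_B (n : ℕ) : (Bfam Fq n).ncard = Fintype.card Fq ^ n := by
  have : Bfam Fq n = Tg gUp '' Mon Fq n := by
    ext M
    constructor
    · intro h
      exact ⟨_, (Tg_dn_mem h).1, (Tg_dn_mem h).2⟩
    · rintro ⟨N, hN, rfl⟩
      exact Tg_up_mem hN
  rw [this, Set.InjOn.ncard_image, (ncard_Mon n).1]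
  intro N hN N' hN' h
  rw [← Tg_dn_up hN.1, ← Tg_dn_up hN'.1, h]

/-! ### Partial fraction data -/

/-- Index type: pairs `(P, i)`. -/
abbrev Idx (Fq : Type) [Field Fq] : Type := (_ : Fq[X]) × ℕ

/-- Admissible data. -/
def Vd (Fq : Type) [Field Fq] : Set (Idx Fq →₀ Fq[X]) :=
  {b | ∀ x ∈ b.support, x.1.Monic ∧ Irreducible x.1 ∧ 1 ≤ x.2 ∧ (b x).degree < x.1.degree}

/-- One partial fraction. -/
def term (x : Idx Fq) (a : Fq[X]) : RatFunc Fq :=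
  algebraMap Fq[X] (RatFunc Fq) a / algebraMap Fq[X] (RatFunc Fq) x.1 ^ (2 * x.2 - 1)

/-- Sum of the partial fractions. -/
def Phi (b : Idx Fq →₀ Fq[X]) : RatFunc Fq := b.sum term

theorem term_zero (x : Idx Fq) : term x 0 = 0 := by simp [term]

theorem Phi_sub (b c : Idx Fq →₀ Fq[X]) : Phi (b - c) = Phi b - Phi c := by
  unfold Phi
  apply Finsupp.sum_sub_index
  intro x a a'
  simp [term, sub_div]

theorem Vd_sub {b c : Idx Fq →₀ Fq[X]} (hb : b ∈ Vd Fq) (hc : c ∈ Vd Fq) : b - c ∈ Vd Fq := by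
  intro x hx
  by_cases h1 : x ∈ b.support
  · obtain ⟨m, i, l, d⟩ := hb x h1
    refine ⟨m, i, l, ?_⟩
    by_cases h2 : x ∈ c.support
    · obtain ⟨-, -, -, d'⟩ := hc x h2
      rw [Finsupp.sub_apply]
      exact (degree_sub_le _ _).trans_lt (max_lt d d')
    · rw [Finsupp.notMem_support_iff] at h2
      simpa [h2] using d
  · rw [Finsupp.notMem_support_iff] at h1
    by_cases h2 : x ∈ c.support
    · obtain ⟨m, i, l, d⟩ := hc x h2
      refine ⟨m, i, l, ?_⟩
      simpa [h1] using d
    · rw [Finsupp.notMem_support_iff] at h2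
      simp [h1, h2] at hx

theorem Phi_eq_poly {b : Idx Fq →₀ Fq[X]} (hb : b ∈ Vd Fq) (p : Fq[X])
    (h : Phi b = algebraMap Fq[X] (RatFunc Fq) p) : b = 0 := by
  by_contra hne
  obtain ⟨x0, hx0⟩ := Finsupp.support_nonempty_iff.2 hne
  obtain ⟨x, hx, hmax⟩ := Finset.exists_max_image (b.support.filter fun y => y.1 = x0.1)
    (fun y => y.2) ⟨x0, Finset.mem_filter.2 ⟨hx0, rfl⟩⟩
  rw [Finset.mem_filter] at hx
  obtain ⟨hxs, hx1⟩ := hx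
  obtain ⟨hm, hi, hk, hd⟩ := hb x hxs
  have hPp : Prime x.1 := hi.prime
  set R : Fq[X] := ∏ y ∈ b.support.filter (fun y => y.1 ≠ x.1), y.1 ^ (2 * y.2 - 1) with hR
  have ane : ∀ Q : Fq[X], Q ≠ 0 → algebraMap Fq[X] (RatFunc Fq) Q ≠ 0 := fun Q hQ =>
    RatFunc.algebraMap_ne_zero hQ
  -- every other term becomes a multiple of `P`
  have key : ∀ y ∈ b.support.erase x, ∃ c, term y (b y) *
      algebraMap Fq[X] (RatFunc Fq) (x.1 ^ (2 * x.2 - 1) * R) =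
      algebraMap Fq[X] (RatFunc Fq) (x.1 * c) := by
    intro y hy
    rw [Finset.mem_erase] at hy
    obtain ⟨hm', hi', hk', -⟩ := hb y hy.2
    have hy0 := ane _ (pow_ne_zero (2 * y.2 - 1) hi'.ne_zero)
    rw [map_pow] at hy0
    have hx0' : x.1 ^ (2 * x.2 - 1) = x.1 * x.1 ^ (2 * x.2 - 2) := by
      rw [← pow_succ']; congr 1; omega
    by_cases hyx : y.1 = x.1
    · have hle : y.2 ≤ x.2 := hmax y (by rw [Finset.mem_filter]; exact ⟨hy.2, hyx.trans hx1⟩)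
      have hlt : y.2 < x.2 := by
        refine lt_of_le_of_ne hle fun h2 => hy.1 ?_
        exact Sigma.ext hyx (heq_of_eq h2)
      refine ⟨b y * x.1 ^ (2 * (x.2 - y.2) - 1) * R, ?_⟩
      have : x.1 ^ (2 * x.2 - 1) = y.1 ^ (2 * y.2 - 1) * (x.1 * x.1 ^ (2 * (x.2 - y.2) - 1)) := by
        rw [hyx, ← pow_succ', ← pow_add]; congr 1; omega
      rw [this, term]
      simp only [map_mul, map_pow]
      field_simp
    · have hdv : y.1 ^ (2 * y.2 - 1) ∣ R :=
        Finset.dvd_prod_of_mem (fun y : Idx Fq => y.1 ^ (2 * y.2 - 1))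
          (Finset.mem_filter.2 ⟨hy.2, hyx⟩)
      obtain ⟨R', hR'⟩ := hdv
      refine ⟨b y * x.1 ^ (2 * x.2 - 2) * R', ?_⟩
      rw [hx0', hR', term]
      simp only [map_mul, map_pow]
      field_simp
  have key2 : ∃ c, (∑ y ∈ b.support.erase x, term y (b y) *
      algebraMap Fq[X] (RatFunc Fq) (x.1 ^ (2 * x.2 - 1) * R)) =
      algebraMap Fq[X] (RatFunc Fq) (x.1 * c) := by
    refine Finset.sum_induction _ (fun z => ∃ c, z = algebraMap Fq[X] (RatFunc Fq) (x.1 * c))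
      ?_ ⟨0, by simp⟩ key
    rintro _ _ ⟨c, rfl⟩ ⟨d, rfl⟩
    exact ⟨c + d, by rw [mul_add, map_add]⟩
  obtain ⟨c, hc⟩ := key2
  have hxt : term x (b x) * algebraMap Fq[X] (RatFunc Fq) (x.1 ^ (2 * x.2 - 1) * R) =
      algebraMap Fq[X] (RatFunc Fq) (b x * R) := by
    have hx0 := ane _ (pow_ne_zero (2 * x.2 - 1) hi.ne_zero)
    rw [map_pow] at hx0
    rw [term]
    simp only [map_mul, map_pow]
    field_simp
  have hsum : Phi b * algebraMap Fq[X] (RatFunc Fq) (x.1 ^ (2 * x.2 - 1) * R) =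
      algebraMap Fq[X] (RatFunc Fq) (b x * R + x.1 * c) := by
    rw [map_add, ← hxt, ← hc, Phi, Finsupp.sum, ← Finset.add_sum_erase _ _ hxs, add_mul,
      Finset.sum_mul]
  rw [h, ← map_mul] at hsum
  have hpol := RatFunc.algebraMap_injective Fq hsum
  have hdvd : x.1 ∣ b x * R := by
    have hpol' : b x * R = p * (x.1 ^ (2 * x.2 - 1) * R) - x.1 * c := by
      rw [hpol]; ring
    rw [hpol']
    refine dvd_sub ?_ (dvd_mul_right _ _)
    refine dvd_mul_of_dvd_right (dvd_mul_of_dvd_left (dvd_pow_self _ (by omega)) _) _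
  rcases hPp.dvd_or_dvd hdvd with h1 | h1
  · exact (Finsupp.mem_support_iff.1 hxs) (eq_zero_of_dvd_of_degree_lt h1 hd)
  · rw [hR, hPp.dvd_finsetProd_iff] at h1
    obtain ⟨y, hy, hdy⟩ := h1
    rw [Finset.mem_filter] at hy
    obtain ⟨hm', hi', -, -⟩ := hb y hy.1
    have := hPp.dvd_of_dvd_pow hdy
    exact hy.2 (eq_of_monic_of_associated hm' hm ((hi.associated_of_dvd hi' this).symm))

theorem Phi_injOn : Set.InjOn (Phi (Fq := Fq)) (Vd Fq) := by
  intro b hb c hc h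
  have := Phi_eq_poly (Vd_sub hb hc) 0 (by rw [Phi_sub, h]; simp)
  exact sub_eq_zero.1 this

/-- The monic polynomial attached to data. -/
def Nb (b : Idx Fq →₀ Fq[X]) : Fq[X] :=
  ∏ P ∈ b.support.image Sigma.fst, P ^ (b.support.filter fun y => y.1 = P).sup Sigma.snd

theorem Nb_monic {b : Idx Fq →₀ Fq[X]} (hb : b ∈ Vd Fq) : (Nb b).Monic := by
  refine monic_prod_of_monic _ _ fun P hP => ?_
  obtain ⟨x, hx, rfl⟩ := Finset.mem_image.1 hP
  exact (hb x hx).1.pow _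

theorem Nb_dvd_iff {b : Idx Fq →₀ Fq[X]} (hb : b ∈ Vd Fq) (N : Fq[X]) :
    Nb b ∣ N ↔ ∀ x ∈ b.support, x.1 ^ x.2 ∣ N := by
  constructor
  · intro h x hx
    refine dvd_trans ?_ h
    refine dvd_trans ?_ (Finset.dvd_prod_of_mem _ (Finset.mem_image_of_mem _ hx))
    apply pow_dvd_pow
    have hx' : x ∈ b.support.filter fun y => y.1 = x.1 := Finset.mem_filter.2 ⟨hx, rfl⟩
    exact Finset.le_sup (f := Sigma.snd) hx'
  · intro h
    apply Finset.prod_dvd_of_coprime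
    · intro P hP Q hQ hne
      obtain ⟨x, hx, rfl⟩ := Finset.mem_image.1 hP
      obtain ⟨y, hy, rfl⟩ := Finset.mem_image.1 hQ
      apply IsCoprime.pow
      rw [(hb x hx).2.1.coprime_iff_not_dvd]
      intro hd
      exact hne (eq_of_monic_of_associated (hb x hx).1 (hb y hy).1
        ((hb x hx).2.1.associated_of_dvd (hb y hy).2.1 hd))
    · intro P hP
      obtain ⟨x, hx, rfl⟩ := Finset.mem_image.1 hP
      obtain ⟨y, hy, hyy⟩ := Finset.exists_mem_eq_sup
        (b.support.filter fun y => y.1 = x.1) ⟨x, Finset.mem_filter.2 ⟨hx, rfl⟩⟩ Sigma.snd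
      rw [hyy]
      rw [Finset.mem_filter] at hy
      rw [← hy.2]
      exact h y hy.1

/-- Index set of `N`. -/
def KN (N : Fq[X]) : Finset (Idx Fq) :=
  (nf N).toFinset.sigma fun P => Finset.Icc 1 ((nf N).count P)

theorem mem_KN {N : Fq[X]} (x : Idx Fq) :
    x ∈ KN N ↔ x.1 ∈ nf N ∧ 1 ≤ x.2 ∧ x.2 ≤ (nf N).count x.1 := by
  rw [KN, Finset.mem_sigma, Multiset.mem_toFinset, Finset.mem_Icc]

/-- Data for `N`. -/
def WN (N : Fq[X]) : Set (Idx Fq →₀ Fq[X]) := {b | b ∈ Vd Fq ∧ Nb b ∣ N}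

theorem mem_WN_iff {N : Fq[X]} (hN : N.Monic) (b : Idx Fq →₀ Fq[X]) :
    b ∈ WN N ↔ b.support ⊆ KN N ∧ ∀ x ∈ KN N, (b x).degree < x.1.degree := by
  constructor
  · rintro ⟨hb, hd⟩
    rw [Nb_dvd_iff hb] at hd
    constructor
    · intro x hx
      obtain ⟨m, i, l, d⟩ := hb x hx
      have h1 := (pow_dvd_iff_count hN m i _).1 (hd x hx)
      rw [mem_KN]
      exact ⟨Multiset.count_pos.1 (by omega), l, h1⟩
    · intro x hx
      by_cases h : x ∈ b.support
      · exact (hb x h).2.2.2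
      · rw [Finsupp.notMem_support_iff] at h
        rw [h, degree_zero, bot_lt_iff_ne_bot, Ne, degree_eq_bot]
        exact (nf_spec ((mem_KN x).1 hx).1).2.ne_zero
  · rintro ⟨h1, h2⟩
    have hb : b ∈ Vd Fq := by
      intro x hx
      have hk := (mem_KN x).1 (h1 hx)
      exact ⟨(nf_spec hk.1).1, (nf_spec hk.1).2, hk.2.1, h2 x (h1 hx)⟩
    refine ⟨hb, ?_⟩
    rw [Nb_dvd_iff hb]
    intro x hx
    have hk := (mem_KN x).1 (h1 hx)
    exact (pow_dvd_iff_count hN (nf_spec hk.1).1 (nf_spec hk.1).2 _).2 hk.2.2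

theorem ncard_WN {N : Fq[X]} (hN : N.Monic) :
    (WN N).ncard = Fintype.card Fq ^ N.natDegree ∧ (WN N).Finite := by
  have h : WN N = ((KN N).finsupp fun x => (ncard_degLT (Fq := Fq) x.1.natDegree).2.toFinset :
      Finset (Idx Fq →₀ Fq[X])) := by
    ext b
    rw [mem_WN_iff hN, Finset.mem_coe, Finset.mem_finsupp_iff]
    refine and_congr_right fun _ => forall₂_congr fun x hx => ?_
    rw [Set.Finite.mem_toFinset, Set.mem_ofPred_eq,
      degree_eq_natDegree (nf_spec ((mem_KN x).1 hx).1).2.ne_zero]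
  rw [h]
  refine ⟨?_, Finset.finite_toSet _⟩
  rw [Set.ncard_coe_finset, Finset.card_finsupp]
  have : ∀ x ∈ KN N, (ncard_degLT (Fq := Fq) x.1.natDegree).2.toFinset.card =
      Fintype.card Fq ^ x.1.natDegree := by
    intro x _
    rw [← Set.ncard_eq_toFinset_card _ (ncard_degLT (Fq := Fq) x.1.natDegree).2]
    exact (ncard_degLT _).1
  rw [Finset.prod_congr rfl this, Finset.prod_pow_eq_pow_sum, natDegree_eq_sum hN]
  congr 1
  rw [KN, Finset.sum_sigma]
  refine Finset.sum_congr rfl fun P _ => ?_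
  simp

/-- Data of exact level `n`. -/
def VF (Fq : Type) [Field Fq] (n : ℕ) : Set (Idx Fq →₀ Fq[X]) :=
  {b | b ∈ Vd Fq ∧ (Nb b).natDegree = n}

/-- Pairs (data, polynomial). -/
def XE (Fq : Type) [Field Fq] (n : ℕ) : Set ((Idx Fq →₀ Fq[X]) × Fq[X]) :=
  {z | z.2 ∈ Mon Fq n ∧ z.1 ∈ WN z.2}

theorem ncard_biU {α ι : Type*} (s : Finset ι) (A : ι → Set α) (hf : ∀ i ∈ s, (A i).Finite)
    (hd : ∀ i ∈ s, ∀ j ∈ s, ∀ x, x ∈ A i → x ∈ A j → i = j) :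
    (⋃ i ∈ s, A i).ncard = ∑ i ∈ s, (A i).ncard := by
  have := Set.Finite.ncard_biUnion s.finite_toSet (s := A) hf (by
    intro i hi j hj hne
    refine Set.disjoint_left.2 fun x hx hx' => hne (hd i hi j hj x hx hx'))
  rw [finsum_mem_coe_finset] at this
  simpa using this

theorem ncard_XE (n : ℕ) : (XE Fq n).ncard = Fintype.card Fq ^ (2 * n) ∧ (XE Fq n).Finite := by
  have h : XE Fq n = ⋃ N ∈ (ncard_Mon (Fq := Fq) n).2.toFinset, WN N ×ˢ {N} := by
    ext ⟨b, N⟩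
    simp only [XE, Set.mem_ofPred_eq, Set.mem_iUnion, Set.mem_prod, Set.mem_singleton_iff,
      Set.Finite.mem_toFinset]
    constructor
    · rintro ⟨h1, h2⟩
      exact ⟨N, h1, h2, rfl⟩
    · rintro ⟨_, h1, h2, rfl⟩
      exact ⟨h1, h2⟩
  have hfin : ∀ N ∈ (ncard_Mon (Fq := Fq) n).2.toFinset, (WN N ×ˢ {N}).Finite := by
    intro N hN
    rw [Set.Finite.mem_toFinset] at hN
    exact (ncard_WN hN.1).2.prod (Set.finite_singleton N)
  constructor
  · rw [h, ncard_biU _ _ hfin]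
    · have : ∀ N ∈ (ncard_Mon (Fq := Fq) n).2.toFinset,
          (WN N ×ˢ {N}).ncard = Fintype.card Fq ^ n := by
        intro N hN
        rw [Set.Finite.mem_toFinset] at hN
        rw [Set.ncard_prod, (ncard_WN hN.1).1, Set.ncard_singleton, mul_one, hN.2]
      rw [Finset.sum_congr rfl this, Finset.sum_const, smul_eq_mul,
        ← Set.ncard_eq_toFinset_card _ (ncard_Mon (Fq := Fq) n).2, (ncard_Mon n).1]
      ring
    · rintro N _ N' _ ⟨b, M⟩ h1 h2
      exact h1.2.symm.trans h2.2
  · rw [h]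
    exact Set.Finite.biUnion (Finset.finite_toSet _) hfin

theorem VF_finite (n : ℕ) : (VF Fq n).Finite := by
  refine Set.Finite.subset ((ncard_XE (Fq := Fq) n).2.image Prod.fst) ?_
  intro b hb
  exact ⟨(b, Nb b), ⟨⟨Nb_monic hb.1, hb.2⟩, hb.1, dvd_rfl⟩, rfl⟩

theorem sum_VF (n : ℕ) :
    ∑ d ∈ Finset.range (n + 1), (VF Fq d).ncard * Fintype.card Fq ^ (n - d) =
      Fintype.card Fq ^ (2 * n) := by
  rw [← (ncard_XE n).1]
  have h : XE Fq n = (fun z : (Idx Fq →₀ Fq[X]) × Fq[X] => (z.1, Nb z.1 * z.2)) ''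
      ⋃ d ∈ Finset.range (n + 1), VF Fq d ×ˢ Mon Fq (n - d) := by
    ext ⟨b, N⟩
    simp only [XE, Set.mem_ofPred_eq, Set.mem_iUnion, Set.mem_prod, Set.mem_image, Prod.mk.injEq,
      Prod.exists, Finset.mem_range]
    constructor
    · rintro ⟨⟨hN, hn⟩, hb, Q, rfl⟩
      have hQ : Q.Monic := (Nb_monic hb).of_mul_monic_left hN
      rw [(Nb_monic hb).natDegree_mul hQ] at hn
      exact ⟨b, Q, ⟨(Nb b).natDegree, by omega, ⟨hb, rfl⟩, hQ, by omega⟩, rfl, rfl⟩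
    · rintro ⟨_, Q, ⟨d, hd, ⟨hb, hbd⟩, hQ, hQd⟩, rfl, rfl⟩
      refine ⟨⟨(Nb_monic hb).mul hQ, ?_⟩, hb, dvd_mul_right _ _⟩
      rw [(Nb_monic hb).natDegree_mul hQ]
      omega
  rw [h, Set.InjOn.ncard_image, ncard_biU]
  · refine Finset.sum_congr rfl fun d _ => ?_
    rw [Set.ncard_prod, (ncard_Mon _).1]
  · intro d _
    exact (VF_finite d).prod (ncard_Mon _).2
  · rintro d _ d' _ ⟨b, Q⟩ h1 h2
    exact h1.1.2.symm.trans h2.1.2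
  · rintro ⟨b, Q⟩ h1 ⟨b', Q'⟩ h2 heq
    simp only [Prod.mk.injEq] at heq
    obtain ⟨rfl, h3⟩ := heq
    simp only [Set.mem_iUnion] at h1
    obtain ⟨d, _, h1, _⟩ := h1
    rw [mul_left_cancel₀ (Nb_monic h1.1).ne_zero h3]

theorem ncard_VF_zero : (VF Fq 0).ncard = 1 := by
  have := sum_VF (Fq := Fq) 0
  simpa using this

theorem ncard_VF_succ (n : ℕ) : (VF Fq (n + 1)).ncard + Fintype.card Fq ^ (2 * n + 1) =
    Fintype.card Fq ^ (2 * n + 2) := by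
  have h1 := sum_VF (Fq := Fq) (n + 1)
  have h0 := sum_VF (Fq := Fq) n
  rw [Finset.sum_range_succ] at h1
  have : ∑ d ∈ Finset.range (n + 1), (VF Fq d).ncard * Fintype.card Fq ^ (n + 1 - d) =
      Fintype.card Fq ^ (2 * n + 1) := by
    rw [pow_succ, ← h0, Finset.sum_mul]
    refine Finset.sum_congr rfl fun d hd => ?_
    rw [Finset.mem_range] at hd
    rw [show n + 1 - d = n - d + 1 by omega, pow_succ, mul_assoc]
  rw [this, Nat.sub_self, pow_zero, mul_one] at h1
  rw [add_comm, h1]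
  ring

/-! ### The families as images -/

theorem Phi_eq_sum {b : Idx Fq →₀ Fq[X]} (S : Finset Fq[X]) (e : Fq[X] → ℕ)
    (h : b.support ⊆ S.sigma fun P => Finset.Icc 1 (e P)) :
    Phi b = ∑ P ∈ S, ∑ i ∈ Finset.Icc 1 (e P),
      algebraMap Fq[X] (RatFunc Fq) (b ⟨P, i⟩) / algebraMap Fq[X] (RatFunc Fq) P ^ (2 * i - 1) := by
  rw [Phi, Finsupp.sum_of_support_subset b h term (fun x _ => term_zero x), Finset.sum_sigma]
  rfl

theorem Vd_degree {b : Idx Fq →₀ Fq[X]} (hb : b ∈ Vd Fq) {P : Fq[X]} (hP : P ≠ 0) (i : ℕ) :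
    (b ⟨P, i⟩).degree < P.degree := by
  by_cases h : (⟨P, i⟩ : Idx Fq) ∈ b.support
  · exact (hb _ h).2.2.2
  · rw [Finsupp.notMem_support_iff] at h
    rw [h, degree_zero, bot_lt_iff_ne_bot, Ne, degree_eq_bot]
    exact hP

theorem exists_data (S : Finset Fq[X]) (e : Fq[X] → ℕ) (a : Fq[X] → ℕ → Fq[X])
    (hS : ∀ P ∈ S, P.Monic ∧ Irreducible P)
    (ha : ∀ P ∈ S, ∀ i, 1 ≤ i → i ≤ e P → (a P i).degree < P.degree) :
    ∃ b ∈ Vd Fq, (b.support ⊆ S.sigma fun P => Finset.Icc 1 (e P)) ∧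
      (∀ P ∈ S, ∀ i, 1 ≤ i → i ≤ e P → b ⟨P, i⟩ = a P i) ∧
      Phi b = ∑ P ∈ S, ∑ i ∈ Finset.Icc 1 (e P),
        algebraMap Fq[X] (RatFunc Fq) (a P i) /
          algebraMap Fq[X] (RatFunc Fq) P ^ (2 * i - 1) := by
  set K : Finset (Idx Fq) := S.sigma fun P => Finset.Icc 1 (e P) with hK
  let b : Idx Fq →₀ Fq[X] := Finsupp.onFinset K (fun x => if x ∈ K then a x.1 x.2 else 0)
    (fun x hx => by by_contra h; simp [h] at hx)
  have hsub : b.support ⊆ K := Finsupp.support_onFinset_subset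
  have hval : ∀ P ∈ S, ∀ i, 1 ≤ i → i ≤ e P → b ⟨P, i⟩ = a P i := by
    intro P hP i h1 h2
    have : (⟨P, i⟩ : Idx Fq) ∈ K := Finset.mem_sigma.2 ⟨hP, Finset.mem_Icc.2 ⟨h1, h2⟩⟩
    change (if (⟨P, i⟩ : Idx Fq) ∈ K then a P i else 0) = _
    rw [if_pos this]
  refine ⟨b, ?_, hsub, hval, ?_⟩
  · rintro ⟨P, i⟩ hx
    have := Finset.mem_sigma.1 (hsub hx)
    obtain ⟨h1, h2⟩ := this
    rw [Finset.mem_Icc] at h2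
    refine ⟨(hS P h1).1, (hS P h1).2, h2.1, ?_⟩
    rw [hval P h1 i h2.1 h2.2]
    exact ha P h1 i h2.1 h2.2
  · rw [Phi_eq_sum S e hsub]
    refine Finset.sum_congr rfl fun P hP => Finset.sum_congr rfl fun i hi => ?_
    rw [Finset.mem_Icc] at hi
    rw [hval P hP i hi.1 hi.2]

theorem Ffam_eq (n : ℕ) : Ffam Fq n = Phi '' VF Fq n := by
  ext u
  constructor
  · rintro ⟨S, e, a, hS, he, ha, ht, hn, rfl⟩
    obtain ⟨b, hb, hsub, hval, hPhi⟩ := exists_data S e a hS ha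
    refine ⟨b, ⟨hb, ?_⟩, hPhi⟩
    have htop : ∀ P ∈ S, (⟨P, e P⟩ : Idx Fq) ∈ b.support := by
      intro P hP
      rw [Finsupp.mem_support_iff, hval P hP _ (he P hP) le_rfl]
      exact ht P hP
    have himg : b.support.image Sigma.fst = S := by
      ext P
      rw [Finset.mem_image]
      constructor
      · rintro ⟨x, hx, rfl⟩
        exact (Finset.mem_sigma.1 (hsub hx)).1
      · intro hP
        exact ⟨_, htop P hP, rfl⟩
    rw [← hn, Nb, himg, natDegree_prod_of_monic _ _ fun P hP => (hS P hP).1.pow _]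
    refine Finset.sum_congr rfl fun P hP => ?_
    rw [natDegree_pow]
    congr 1
    apply le_antisymm
    · refine Finset.sup_le fun x hx => ?_
      rw [Finset.mem_filter] at hx
      have := Finset.mem_Icc.1 (Finset.mem_sigma.1 (hsub hx.1)).2
      rw [← hx.2]
      exact this.2
    · have hx' : (⟨P, e P⟩ : Idx Fq) ∈ b.support.filter fun y => y.1 = P :=
        Finset.mem_filter.2 ⟨htop P hP, rfl⟩
      exact Finset.le_sup (f := Sigma.snd) hx'
  · rintro ⟨b, ⟨hb, hn⟩, rfl⟩
    have hle : ∀ x ∈ b.support,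
        x.2 ≤ (b.support.filter fun y => y.1 = x.1).sup Sigma.snd := by
      intro x hx
      have hx' : x ∈ b.support.filter fun y => y.1 = x.1 := Finset.mem_filter.2 ⟨hx, rfl⟩
      exact Finset.le_sup (f := Sigma.snd) hx'
    have hS : ∀ P ∈ b.support.image Sigma.fst, P.Monic ∧ Irreducible P := by
      intro P hP
      obtain ⟨x, hx, rfl⟩ := Finset.mem_image.1 hP
      exact ⟨(hb x hx).1, (hb x hx).2.1⟩
    refine ⟨b.support.image Sigma.fst,
      fun P => (b.support.filter fun y => y.1 = P).sup Sigma.snd, fun P i => b ⟨P, i⟩, hS,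
      ?_, ?_, ?_, ?_, ?_⟩
    · intro P hP
      obtain ⟨x, hx, rfl⟩ := Finset.mem_image.1 hP
      exact (hb x hx).2.2.1.trans (hle x hx)
    · intro P hP i _ _
      exact Vd_degree hb (hS P hP).2.ne_zero i
    · intro P hP
      obtain ⟨x, hx, rfl⟩ := Finset.mem_image.1 hP
      obtain ⟨y, hy, hyy⟩ := Finset.exists_mem_eq_sup
        (b.support.filter fun y => y.1 = x.1) ⟨x, Finset.mem_filter.2 ⟨hx, rfl⟩⟩ Sigma.snd
      rw [Finset.mem_filter] at hy
      change b ⟨x.1, (b.support.filter fun y => y.1 = x.1).sup Sigma.snd⟩ ≠ 0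
      rw [hyy, ← hy.2]
      exact Finsupp.mem_support_iff.1 hy.1
    · rw [← hn, Nb, natDegree_prod_of_monic _ _ fun P hP => (hS P hP).1.pow _]
      exact Finset.sum_congr rfl fun P hP => (natDegree_pow _ _).symm
    · apply Phi_eq_sum
      intro x hx
      exact Finset.mem_sigma.2 ⟨Finset.mem_image_of_mem _ hx,
        Finset.mem_Icc.2 ⟨(hb x hx).2.2.1, hle x hx⟩⟩

theorem ncard_F (n : ℕ) : (Ffam Fq n).ncard = (VF Fq n).ncard ∧ (Ffam Fq n).Finite := by
  rw [Ffam_eq]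
  refine ⟨?_, (VF_finite n).image _⟩
  exact Set.InjOn.ncard_image (Phi_injOn.mono fun b hb => hb.1)

theorem exists_num {N : Fq[X]} (hN : N.Monic) {b : Idx Fq →₀ Fq[X]} (hb : b ∈ WN N) :
    ∃ D : Fq[X], D.degree < (Tg gUp N).degree ∧
      Phi b = algebraMap Fq[X] (RatFunc Fq) D / algebraMap Fq[X] (RatFunc Fq) (Tg gUp N) := by
  have hM := Tg_monic gUp N
  have hM0 : algebraMap Fq[X] (RatFunc Fq) (Tg gUp N) ≠ 0 :=
    RatFunc.algebraMap_ne_zero hM.ne_zero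
  have hsub := ((mem_WN_iff hN b).1 hb).1
  refine Finset.sum_induction _ (fun z => ∃ D : Fq[X], D.degree < (Tg gUp N).degree ∧
      z = algebraMap Fq[X] (RatFunc Fq) D / algebraMap Fq[X] (RatFunc Fq) (Tg gUp N)) ?_ ?_ ?_
  · rintro _ _ ⟨c, hc, rfl⟩ ⟨d, hd, rfl⟩
    exact ⟨c + d, (degree_add_le _ _).trans_lt (max_lt hc hd), by rw [map_add, add_div]⟩
  · refine ⟨0, ?_, by simp⟩
    rw [degree_zero, bot_lt_iff_ne_bot, Ne, degree_eq_bot]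
    exact hM.ne_zero
  · intro x hx
    obtain ⟨m, i, l, d⟩ := hb.1 x hx
    have hk := (mem_KN x).1 (hsub hx)
    have hdvd : x.1 ^ (2 * x.2 - 1) ∣ Tg gUp N := by
      rw [pow_dvd_iff_count hM m i, count_Tg gUp rfl]
      unfold gUp
      have := hk.2.2
      omega
    obtain ⟨R, hR⟩ := hdvd
    have hR0 : R ≠ 0 := by
      rintro rfl
      rw [mul_zero] at hR
      exact hM.ne_zero hR
    have hx0 : algebraMap Fq[X] (RatFunc Fq) x.1 ≠ 0 := RatFunc.algebraMap_ne_zero i.ne_zero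
    have hR0' : algebraMap Fq[X] (RatFunc Fq) R ≠ 0 := RatFunc.algebraMap_ne_zero hR0
    refine ⟨b x * R, ?_, ?_⟩
    · have hle : x.1 * R ∣ Tg gUp N := by
        rw [hR]
        exact mul_dvd_mul_right (dvd_pow_self _ (by omega)) _
      refine lt_of_lt_of_le ?_ (degree_le_of_dvd hle hM.ne_zero)
      by_cases hbx : b x = 0
      · rw [hbx, zero_mul, degree_zero, bot_lt_iff_ne_bot, Ne, degree_eq_bot]
        exact mul_ne_zero i.ne_zero hR0
      · rw [← natDegree_lt_natDegree_iff (mul_ne_zero hbx hR0), natDegree_mul hbx hR0,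
          natDegree_mul i.ne_zero hR0]
        have := (natDegree_lt_natDegree_iff hbx).2 d
        omega
    · rw [hR, term]
      simp only [map_mul, map_pow]
      field_simp

theorem ncard_E (n : ℕ) : (Efam Fq n).ncard = Fintype.card Fq ^ (2 * n) := by
  have hnum : ∀ (N D : Fq[X]) (b : Idx Fq →₀ Fq[X]), Phi b = algebraMap Fq[X] (RatFunc Fq) D /
      algebraMap Fq[X] (RatFunc Fq) (Tg gUp N) →
      (Phi b * algebraMap Fq[X] (RatFunc Fq) (Tg gUp N)).num = D := by
    intro N D b h
    have hM0 : algebraMap Fq[X] (RatFunc Fq) (Tg gUp N) ≠ 0 :=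
      RatFunc.algebraMap_ne_zero (Tg_monic gUp N).ne_zero
    rw [h, div_mul_cancel₀ _ hM0, RatFunc.num_algebraMap]
  have h : Efam Fq n = (fun z : (Idx Fq →₀ Fq[X]) × Fq[X] =>
      ((Phi z.1 * algebraMap Fq[X] (RatFunc Fq) (Tg gUp z.2)).num, Tg gUp z.2)) '' XE Fq n := by
    ext ⟨D, M⟩
    constructor
    · rintro ⟨hM, hd, a, ha, heq⟩
      dsimp only at hM hd ha heq
      obtain ⟨hN, hUp⟩ := Tg_dn_mem hM
      obtain ⟨b, hb, hsub, hval, hPhi⟩ := exists_data (nf M).toFinset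
        (fun P => ((nf M).count P + 1) / 2) a
        (fun P hP => nf_spec (Multiset.mem_toFinset.1 hP)) ha
      have hK : ((nf M).toFinset.sigma fun P => Finset.Icc 1 (((nf M).count P + 1) / 2)) =
          KN (Tg gDn M) := by
        rw [KN, support_Tg gDn (by intro c; unfold gDn; omega)]
        simp_rw [count_Tg gDn rfl]
      refine ⟨(b, Tg gDn M), ⟨hN, ?_⟩, ?_⟩
      · change b ∈ WN (Tg gDn M)
        rw [mem_WN_iff hN.1]
        refine ⟨hK ▸ hsub, fun x hx => ?_⟩
        exact Vd_degree hb (nf_spec ((mem_KN x).1 hx).1).2.ne_zero x.2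
      · dsimp only
        rw [hnum _ D b (by rw [hUp, hPhi]; exact heq.symm), hUp]
    · rintro ⟨⟨b, N⟩, ⟨hN, hb⟩, heq⟩
      dsimp only at hN hb heq
      obtain ⟨D', hD', hPhi⟩ := exists_num hN.1 hb
      rw [hnum _ _ _ hPhi, Prod.mk.injEq] at heq
      obtain ⟨rfl, rfl⟩ := heq
      have hsup := support_Tg gUp (by intro c; unfold gUp; omega) N
      have hcnt : ∀ P, ((nf (Tg gUp N)).count P + 1) / 2 = (nf N).count P := by
        intro P
        rw [count_Tg gUp rfl]; unfold gUp; omega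
      refine ⟨Tg_up_mem hN, hD', fun P i => b ⟨P, i⟩, ?_, ?_⟩
      · intro P hP i _ _
        exact Vd_degree hb.1 (nf_spec (Multiset.mem_toFinset.1 hP)).2.ne_zero i
      · dsimp only
        rw [← hPhi]
        apply Phi_eq_sum
        change b.support ⊆ (nf (Tg gUp N)).toFinset.sigma
          fun P => Finset.Icc 1 (((nf (Tg gUp N)).count P + 1) / 2)
        rw [hsup]
        simp_rw [hcnt]
        exact ((mem_WN_iff hN.1 b).1 hb).1
  rw [h, Set.InjOn.ncard_image, (ncard_XE n).1]
  rintro ⟨b, N⟩ ⟨hN, hb⟩ ⟨b', N'⟩ ⟨hN', hb'⟩ heq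
  dsimp only at hN hb hN' hb' heq
  rw [Prod.mk.injEq] at heq
  have hNN : N = N' := by rw [← Tg_dn_up hN.1, ← Tg_dn_up hN'.1, heq.2]
  subst hNN
  obtain ⟨D, -, hPhi⟩ := exists_num hN.1 hb
  obtain ⟨D', -, hPhi'⟩ := exists_num hN.1 hb'
  rw [hnum _ _ _ hPhi, hnum _ _ _ hPhi'] at heq
  rw [Prod.mk.injEq]
  refine ⟨Phi_injOn hb.1 hb'.1 ?_, rfl⟩
  rw [hPhi, hPhi', heq.1]

/-! ### The polynomial part -/

/-- The polynomial with given odd coefficients. -/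
def Gmk (s : ℕ) (α : Fq) (c : ℕ → Fq) : Fq[X] :=
  C α + ∑ i ∈ Finset.Icc 1 s, C (c i) * X ^ (2 * i - 1)

theorem Gmk_coeff (s : ℕ) (α : Fq) (c : ℕ → Fq) {j : ℕ} (hj : 1 ≤ j) :
    (Gmk s α c).coeff (2 * j - 1) = if j ∈ Finset.Icc 1 s then c j else 0 := by
  rw [Gmk, coeff_add, coeff_C_ne_zero (by omega), zero_add, finsetSum_coeff,
    ← Finset.sum_ite_eq (Finset.Icc 1 s) j c]
  refine Finset.sum_congr rfl fun i hi => ?_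
  rw [Finset.mem_Icc] at hi
  rw [coeff_C_mul, coeff_X_pow]
  by_cases h : j = i
  · subst h; simp
  · rw [if_neg (by omega), if_neg h, mul_zero]

theorem Gmk_coeff_zero (s : ℕ) (α : Fq) (c : ℕ → Fq) : (Gmk s α c).coeff 0 = α := by
  rw [Gmk, coeff_add, coeff_C_zero, finsetSum_coeff, Finset.sum_eq_zero, add_zero]
  intro i hi
  rw [Finset.mem_Icc] at hi
  rw [coeff_C_mul, coeff_X_pow, if_neg (by omega), mul_zero]

theorem G_disj {ξ : Fq} {s s' : ℕ} (hs : 1 ≤ s) (hs' : 1 ≤ s') {G : Fq[X]}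
    (h : G ∈ Gfam ξ s) (h' : G ∈ Gfam ξ s') : s = s' := by
  have key : ∀ t t' : ℕ, 1 ≤ t → 1 ≤ t' → G ∈ Gfam ξ t → G ∈ Gfam ξ t' → t' ≤ t := by
    intro t t' ht ht' h h'
    obtain ⟨α, c, -, hc, e⟩ := h
    obtain ⟨α', c', -, hc', e'⟩ := h'
    change G = Gmk t α c at e
    change G = Gmk t' α' c' at e'
    by_contra hlt
    have h1 := Gmk_coeff t α c ht'
    have h2 := Gmk_coeff t' α' c' ht'
    rw [← e, if_neg (by rw [Finset.mem_Icc]; omega)] at h1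
    rw [← e', if_pos (by rw [Finset.mem_Icc]; omega), h1] at h2
    exact hc' h2.symm
  exact le_antisymm (key s' s hs' hs h' h) (key s s' hs hs' h h')

theorem ncard_G {ξ : Fq} (hξ : ξ ≠ 0) (m : ℕ) :
    (Gfam ξ (m + 1)).ncard = 2 * (Fintype.card Fq - 1) * Fintype.card Fq ^ m ∧
      (Gfam ξ (m + 1)).Finite := by
  let A : Finset (Fin (m + 1) → Fq) :=
    Fintype.piFinset fun i => if i = Fin.last m then Finset.univ.erase 0 else Finset.univ
  have hA : A.card = (Fintype.card Fq - 1) * Fintype.card Fq ^ m := by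
    rw [Fintype.card_piFinset, Fin.prod_univ_castSucc]
    have : ∀ i : Fin m, ((if i.castSucc = Fin.last m then Finset.univ.erase (0 : Fq)
        else Finset.univ).card) = Fintype.card Fq := by
      intro i
      rw [if_neg (Fin.castSucc_lt_last i).ne, Finset.card_univ]
    rw [Finset.prod_congr rfl fun i _ => this i]
    simp [mul_comm]
  have hmem : ∀ c, c ∈ A ↔ c (Fin.last m) ≠ 0 := by
    intro c
    rw [Fintype.mem_piFinset]
    constructor
    · intro h
      have := h (Fin.last m)
      simpa using this
    · intro h i
      split_ifs with hi
      · subst hi; simpa using h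
      · simp
  let ex : (Fin (m + 1) → Fq) → ℕ → Fq := fun c i => c (Fin.ofNat (m + 1) (i - 1))
  have hex : ∀ c (i : Fin (m + 1)), ex c (i.1 + 1) = c i := by
    intro c i
    change c (Fin.ofNat (m + 1) (i.1 + 1 - 1)) = c i
    congr 1
    apply Fin.ext
    simp [Fin.ofNat, Nat.mod_eq_of_lt i.2]
  have h : Gfam ξ (m + 1) = (fun z : Fq × (Fin (m + 1) → Fq) => Gmk (m + 1) z.1 (ex z.2)) ''
      (({0, ξ} ×ˢ A : Finset (Fq × (Fin (m + 1) → Fq))) : Set _) := by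
    ext G
    simp only [Set.mem_image, Finset.mem_coe, Finset.mem_product, Finset.mem_insert,
      Finset.mem_singleton, hmem, Prod.exists]
    constructor
    · rintro ⟨α, c, hα, hc, rfl⟩
      refine ⟨α, fun i => c (i.1 + 1), ⟨hα, hc⟩, ?_⟩
      rw [Gmk]
      congr 1
      refine Finset.sum_congr rfl fun i hi => ?_
      rw [Finset.mem_Icc] at hi
      have := hex (fun i => c (i.1 + 1)) ⟨i - 1, by omega⟩
      simp only [Nat.sub_add_cancel hi.1] at this
      rw [this]
    · rintro ⟨α, c, ⟨hα, hc⟩, rfl⟩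
      refine ⟨α, ex c, hα, ?_, rfl⟩
      rw [← hex c (Fin.last m)] at hc
      exact hc
  rw [h]
  refine ⟨?_, (Finset.finite_toSet _).image _⟩
  rw [Set.InjOn.ncard_image, Set.ncard_coe_finset, Finset.card_product, hA,
    Finset.card_pair hξ.symm, mul_assoc]
  rintro ⟨α, c⟩ - ⟨α', c'⟩ - heq
  dsimp only at heq
  rw [Prod.mk.injEq]
  constructor
  · rw [← Gmk_coeff_zero (m + 1) α (ex c), heq, Gmk_coeff_zero]
  · funext i
    have h1 := Gmk_coeff (m + 1) α (ex c) (j := i.1 + 1) (by omega)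
    have h2 := Gmk_coeff (m + 1) α' (ex c') (j := i.1 + 1) (by omega)
    have hi : i.1 + 1 ∈ Finset.Icc 1 (m + 1) := by
      rw [Finset.mem_Icc]; have := i.2; omega
    rw [if_pos hi, hex] at h1 h2
    rw [← h1, heq, h2]

theorem ncard_I {ξ : Fq} (hξ : ξ ≠ 0) (n : ℕ) :
    (Ifam ξ (n + 1)).ncard = 2 * (Fintype.card Fq - 1) * Fintype.card Fq ^ (2 * n) := by
  have h : Ifam ξ (n + 1) = (fun z : RatFunc Fq × Fq[X] =>
      z.1 + algebraMap Fq[X] (RatFunc Fq) z.2) ''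
      ⋃ r ∈ Finset.range (n + 1), Ffam Fq r ×ˢ Gfam ξ (n - r + 1) := by
    ext u
    simp only [Ifam, Irs, Set.mem_iUnion, Set.mem_image, Set.mem_ofPred_eq, Finset.mem_range,
      Set.mem_prod, Prod.exists]
    constructor
    · rintro ⟨r, s, hs, hrs, v, hv, G, hG, rfl⟩
      refine ⟨v, G, ⟨r, by omega, hv, ?_⟩, rfl⟩
      rwa [show n - r + 1 = s by omega]
    · rintro ⟨v, G, ⟨r, hr, hv, hG⟩, rfl⟩
      exact ⟨r, n - r + 1, by omega, by omega, v, hv, G, hG, rfl⟩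
  rw [h, Set.InjOn.ncard_image, ncard_biU]
  · rw [← sum_VF n, Finset.mul_sum]
    refine Finset.sum_congr rfl fun r _ => ?_
    rw [Set.ncard_prod, (ncard_F r).1, (ncard_G hξ _).1]
    ring
  · intro r _
    exact (ncard_F r).2.prod (ncard_G hξ _).2
  · rintro r hr r' hr' ⟨v, G⟩ h1 h2
    rw [Finset.mem_range] at hr hr'
    have := G_disj (by omega) (by omega) h1.2 h2.2
    omega
  · rintro ⟨v, G⟩ h1 ⟨v', G'⟩ h2 heq
    simp only [Set.mem_iUnion] at h1 h2
    obtain ⟨r, _, h1, _⟩ := h1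
    obtain ⟨r', _, h2, _⟩ := h2
    dsimp only at h1 h2 heq
    rw [Ffam_eq] at h1 h2
    obtain ⟨b, hb, rfl⟩ := h1
    obtain ⟨b', hb', rfl⟩ := h2
    have h0 := Phi_eq_poly (Vd_sub hb.1 hb'.1) (G' - G) (by
      rw [Phi_sub, map_sub, sub_eq_sub_iff_add_eq_add, heq, add_comm])
    rw [sub_eq_zero] at h0
    subst h0
    rw [RatFunc.algebraMap_injective Fq (add_left_cancel heq)]

end Helpers

theorem statement1 {Fq : Type} [Field Fq] [Fintype Fq] (hchar : ringChar Fq = 2)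
    (ξ : Fq) (hξ : ∀ x : Fq, x ^ 2 + x ≠ ξ) (n : ℕ) (hn : 1 ≤ n) :
    Nat.card (Bfam Fq n) = Fintype.card Fq ^ n ∧
    Nat.card (Efam Fq n) = Fintype.card Fq ^ (2 * n) ∧
    (Nat.card (Ffam Fq n) : ℝ) =
      (zetaR (Fintype.card Fq) 2)⁻¹ * (Fintype.card Fq : ℝ) ^ (2 * n) ∧
    (Nat.card (Ifam ξ n) : ℝ) =
      2 * (zetaR (Fintype.card Fq) 2)⁻¹ * (Fintype.card Fq : ℝ) ^ (2 * n - 1) := by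
  obtain ⟨m, rfl⟩ : ∃ m, n = m + 1 := ⟨n - 1, by omega⟩
  have hξ0 : ξ ≠ 0 := fun h => hξ 0 (by rw [h]; ring)
  have hq : 1 < Fintype.card Fq := Fintype.one_lt_card
  have hq0 : (Fintype.card Fq : ℝ) ≠ 0 := by
    have : (Fintype.card Fq) ≠ 0 := by omega
    exact_mod_cast this
  have hz : (zetaR (Fintype.card Fq) 2)⁻¹ = 1 - (Fintype.card Fq : ℝ)⁻¹ := by
    rw [zetaR, inv_inv, show (1 : ℝ) - 2 = -1 by norm_num, Real.rpow_neg_one]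
  refine ⟨?_, ?_, ?_, ?_⟩
  · rw [Nat.card_coe_set_eq, ncard_B]
  · rw [Nat.card_coe_set_eq, ncard_E]
  · rw [Nat.card_coe_set_eq, (ncard_F _).1, hz]
    have h := ncard_VF_succ (Fq := Fq) m
    have h' : ((VF Fq (m + 1)).ncard : ℝ) + (Fintype.card Fq : ℝ) ^ (2 * m + 1) =
        (Fintype.card Fq : ℝ) ^ (2 * m + 2) := by exact_mod_cast h
    rw [eq_sub_of_add_eq h', show 2 * (m + 1) = 2 * m + 1 + 1 by ring, pow_succ]
    field_simp
  · rw [Nat.card_coe_set_eq, ncard_I hξ0, hz, show 2 * (m + 1) - 1 = 2 * m + 1 by omega]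
    rw [Nat.cast_mul, Nat.cast_mul, Nat.cast_sub hq.le, pow_succ]
    push_cast
    field_simp

end EvenChar
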